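/- arXiv:2401.16661 — 2 statements merged into one kernel-verified Lean document; each statement's English description precedes it below -/
import Mathlib

section
/- (Darmois–Skitovich theorem, Proposition 1) Let u and v be independent real-valued random variables and let p, q, r, s be real constants. Define z = p·u + q·v and w = r·u + s·v. If z and w are independent, then: (i) if p·r ≠ 0, the distribution of u is Gaussian, and (ii) if q·s ≠ 0, the distribution of v is Gaussian. -/
open MeasureTheory ProbabilityTheory

/-- A real-valued random variable is Gaussian if its law is a Gaussian measure `N(m, v)`
on `ℝ` for some mean `m : ℝ` and variance `v ≥ 0` (degenerate point masses allowed). -/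
def IsGaussianRV {Ω : Type*} [MeasurableSpace Ω] (P : Measure Ω) (X : Ω → ℝ) : Prop :=
  ∃ (m : ℝ) (v : NNReal), Measure.map X P = gaussianReal m v

/-- A continuous multiplicative map from `ℝ` to `ℂ` is an exponential. -/
theorem exists_eq_exp_of_continuous_of_map_add {f : ℝ → ℂ} (hf : Continuous f) (h0 : f 0 = 1)
    (hadd : ∀ x y, f (x + y) = f x * f y) : ∃ c : ℂ, ∀ x : ℝ, f x = Complex.exp (c * x) := by
  have hder : ∀ x, HasDerivAt (fun t => ∫ s in (0 : ℝ)..t, f s) (f x) x := fun x =>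
    intervalIntegral.integral_hasDerivAt_right (hf.intervalIntegrable _ _)
      hf.stronglyMeasurable.stronglyMeasurableAtFilter hf.continuousAt
  obtain ⟨d, hd⟩ : ∃ d, (∫ s in (0 : ℝ)..d, f s) ≠ 0 := by
    by_contra! h
    have h1 := hder 0
    rw [funext h, h0] at h1
    exact zero_ne_one ((hasDerivAt_const (0 : ℝ) (0 : ℂ)).unique h1)
  set A := ∫ s in (0 : ℝ)..d, f s with hA
  have hrep : ∀ x, f x = ((∫ s in (0 : ℝ)..(x + d), f s) - ∫ s in (0 : ℝ)..x, f s) / A := by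
    intro x
    rw [eq_div_iff hd, hA, intervalIntegral.integral_interval_sub_left
      (hf.intervalIntegrable _ _) (hf.intervalIntegrable _ _),
      ← intervalIntegral.integral_const_mul]
    simp_rw [← hadd]
    simp
  have hfd : ∀ x, HasDerivAt f ((f d - 1) / A * f x) x := by
    intro x
    have h1 := (((hder (x + d)).comp_add_const x d).sub (hder x)).div_const A
    rw [hadd] at h1
    refine (h1.congr_of_eventuallyEq (Filter.Eventually.of_forall hrep)).congr_deriv ?_
    ring
  set c := (f d - 1) / A
  have hexp : ∀ x : ℝ,
      HasDerivAt (fun t : ℝ => Complex.exp (-c * t)) (-c * Complex.exp (-c * x)) x := by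
    intro x
    have h1 : HasDerivAt (fun t : ℝ => -c * (t : ℂ)) (-c) x := by
      simpa using (Complex.ofRealCLM.hasDerivAt (x := x)).const_mul (-c)
    simpa [mul_comm] using h1.cexp
  have hconst : ∀ x : ℝ, f x * Complex.exp (-c * x) = 1 := by
    intro x
    have h1 : ∀ x : ℝ, HasDerivAt (fun t : ℝ => f t * Complex.exp (-c * t)) 0 x := fun x =>
      ((hfd x).mul (hexp x)).congr_deriv (by ring)
    have h2 := is_const_of_deriv_eq_zero (fun x => (h1 x).differentiableAt)
      (fun x => (h1 x).deriv) x 0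
    simpa [h0] using h2
  refine ⟨c, fun x => ?_⟩
  have h1 := hconst x
  rw [neg_mul, Complex.exp_neg] at h1
  field_simp at h1
  exact h1

/-- A continuous additive function on `ℝ` is linear. -/
theorem eq_mul_map_one_of_continuous_of_map_add {L : ℝ → ℝ} (hL : Continuous L)
    (hadd : ∀ x y, L (x + y) = L x + L y) (x : ℝ) : L x = x * L 1 := by
  simpa using map_real_smul (AddMonoidHom.mk' L hadd) hL x 1

/-- A probability measure on `ℝ` is Gaussian if the logarithm of its characteristic function has
vanishing third differences (written multiplicatively). -/
theorem exists_eq_gaussianReal_of_charFun_third_difference (μ : Measure ℝ)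
    [IsProbabilityMeasure μ] (hne : ∀ t, charFun μ t ≠ 0)
    (hdiff : ∀ x y z, charFun μ (x + y + z) * charFun μ x * charFun μ y * charFun μ z =
      charFun μ (x + y) * charFun μ (x + z) * charFun μ (y + z)) :
    ∃ (m : ℝ) (v : NNReal), μ = gaussianReal m v := by
  have hcont : Continuous (charFun μ) := continuous_charFun
  have hneg : ∀ t, charFun μ (-t) = (starRingEnd ℂ) (charFun μ t) := charFun_neg
  have hle : ∀ t, ‖charFun μ t‖ ≤ 1 := norm_charFun_le_one
  have hzero : charFun μ 0 = 1 := by simp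
  suffices h : ∃ (m : ℝ) (v : NNReal), ∀ t : ℝ,
      charFun μ t = Complex.exp (t * m * Complex.I - v * t ^ 2 / 2) by
    obtain ⟨m, v, h⟩ := h
    refine ⟨m, v, Measure.ext_of_charFun (funext fun t => ?_)⟩
    rw [h, charFun_gaussianReal]
  generalize charFun μ = f at *
  -- the second difference of `log f` at the origin is a continuous real bilinear form
  set F : ℝ → ℝ → ℂ := fun x y => f (x + y) / (f x * f y) with hF
  have hFne : ∀ x y, F x y ≠ 0 := fun x y => div_ne_zero (hne _) (mul_ne_zero (hne _) (hne _))
  have hFcomm : ∀ x y, F x y = F y x := fun x y => by simp only [hF, add_comm, mul_comm]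
  have hFadd : ∀ x z y, F (x + z) y = F x y * F z y := by
    intro x z y
    have h1 := hdiff x z y
    have := hne x; have := hne y; have := hne z; have := hne (x + z)
    simp only [hF]
    field_simp
    linear_combination h1
  have hFzero : ∀ y, F 0 y = 1 := fun y => by simp [hF, hzero, hne]
  have hFneg : ∀ x y, F (-x) y = (F x y)⁻¹ := fun x y =>
    eq_inv_of_mul_eq_one_left (by rw [← hFadd, neg_add_cancel, hFzero])
  have hFconj : ∀ x y, (starRingEnd ℂ) (F x y) = F x y := by
    intro x y
    have h1 : F (-x) (-y) = (starRingEnd ℂ) (F x y) := by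
      simp only [hF, ← neg_add, hneg, map_div₀, map_mul]
    rw [← h1, hFneg, hFcomm, hFneg, inv_inv, hFcomm]
  have hFre : ∀ x y, F x y = ((F x y).re : ℂ) := fun x y =>
    (Complex.conj_eq_iff_re.1 (hFconj x y)).symm
  have hFpos : ∀ x y, 0 < (F x y).re := by
    intro x y
    have h1 : F x y = F (x / 2) y * F (x / 2) y := by rw [← hFadd, add_halves]
    have h2 : (F (x / 2) y).re ≠ 0 := fun h => hFne (x / 2) y (by rw [hFre, h, Complex.ofReal_zero])
    rw [h1, hFre (x / 2) y, ← Complex.ofReal_mul, Complex.ofReal_re]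
    exact mul_self_pos.2 h2
  have hlin : ∀ y x, Real.log (F x y).re = x * Real.log (F 1 y).re := by
    intro y
    refine eq_mul_map_one_of_continuous_of_map_add (L := fun x => Real.log (F x y).re) ?_ ?_
    · refine Continuous.log (Complex.continuous_re.comp ?_) fun x => (hFpos x y).ne'
      exact Continuous.div (by fun_prop) (by fun_prop) fun x => mul_ne_zero (hne _) (hne _)
    · intro x z
      rw [hFadd, hFre x y, hFre z y, ← Complex.ofReal_mul]
      simp only [Complex.ofReal_re]
      exact Real.log_mul (hFpos x y).ne' (hFpos z y).ne'
  set κ := Real.log (F 1 1).re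
  have hFexp : ∀ x y, F x y = Complex.exp (x * y * κ) := by
    intro x y
    have h1 : Real.log (F x y).re = x * y * κ := by
      rw [hlin, hFcomm, hlin, mul_assoc]
    rw [hFre, ← Real.exp_log (hFpos x y), h1]
    push_cast
    rfl
  -- removing the quadratic part leaves an exponential
  obtain ⟨c, hc⟩ := exists_eq_exp_of_continuous_of_map_add
    (f := fun t : ℝ => f t * Complex.exp (-(κ * t ^ 2 / 2))) (by fun_prop) (by simp [hzero]) (by
      intro x y
      have h1 : f (x + y) = f x * f y * Complex.exp (x * y * κ) := by
        rw [← hFexp, hF]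
        have := hne x; have := hne y
        field_simp
      simp only [h1]
      have h2 : Complex.exp (-(κ * ((x + y : ℝ) : ℂ) ^ 2 / 2)) =
          Complex.exp (-(κ * x ^ 2 / 2)) * Complex.exp (-(κ * y ^ 2 / 2)) *
            Complex.exp (-(x * y * κ)) := by
        rw [← Complex.exp_add, ← Complex.exp_add]
        congr 1
        push_cast
        ring
      have h3 : Complex.exp (x * y * κ) * Complex.exp (-(x * y * κ)) = 1 := by
        rw [← Complex.exp_add, add_neg_cancel, Complex.exp_zero]
      rw [h2]
      linear_combination f x * f y * Complex.exp (-(κ * x ^ 2 / 2)) *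
        Complex.exp (-(κ * y ^ 2 / 2)) * h3)
  have hfexp : ∀ t : ℝ, f t = Complex.exp (c * t + κ * t ^ 2 / 2) := by
    intro t
    rw [Complex.exp_add, ← hc t, mul_assoc, ← Complex.exp_add, neg_add_cancel, Complex.exp_zero,
      mul_one]
  have hnorm : ∀ t : ℝ, ‖f t‖ = Real.exp (c.re * t + κ * t ^ 2 / 2) := by
    intro t
    have h1 : (c * t + κ * t ^ 2 / 2 : ℂ) = c * t + ((κ * t ^ 2 / 2 : ℝ) : ℂ) := by push_cast; rfl
    rw [hfexp, h1, Complex.norm_exp, Complex.add_re, Complex.ofReal_re, Complex.re_mul_ofReal]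
  have hcre : c.re = 0 := by
    have h1 := congrArg norm (hneg 1)
    rw [RCLike.norm_conj, hnorm, hnorm, Real.exp_eq_exp] at h1
    linarith
  have hκ : κ ≤ 0 := by
    have h1 := hle 1
    rw [hnorm, Real.exp_le_one_iff, hcre] at h1
    linarith
  refine ⟨c.im, (-κ).toNNReal, fun t => ?_⟩
  have hcI : c = c.im * Complex.I := by
    apply Complex.ext <;> simp [hcre]
  rw [hfexp]
  congr 1
  rw [Real.coe_toNNReal _ (neg_nonneg.2 hκ), Complex.ofReal_neg]
  linear_combination (t : ℂ) * hcI

/-- If `f (x + y) * g (m * x + n * y)` splits as a product, with `|m| + |n| = 2`, then neither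
`f` nor `g` vanishes. -/
theorem mul_ne_zero_of_map_add_mul_eq {f g : ℝ → ℂ} (hf : Continuous f) (hg : Continuous g)
    (hf0 : f 0 = 1) (hg0 : g 0 = 1) {m n : ℝ} (hm : m ≠ 0) (hn : n ≠ 0) (hmn : |m| + |n| = 2)
    (h : ∀ x y, f (x + y) * g (m * x + n * y) = f x * g (m * x) * (f y * g (n * y))) (t : ℝ) :
    f t * g t ≠ 0 := by
  have hm' := abs_pos.2 hm
  have hn' := abs_pos.2 hn
  set S := {t | f t * g t = 0} with hS
  by_contra ht
  have hcl : IsClosed S := isClosed_eq (hf.mul hg) continuous_const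
  -- a zero of `f * g` closest to the origin
  obtain ⟨a, haS, ha⟩ := hcl.exists_infDist_eq_dist ⟨t, ht⟩ 0
  have hmin : ∀ b, |b| < |a| → f b ≠ 0 ∧ g b ≠ 0 := by
    intro b hb
    rw [← mul_ne_zero_iff]
    intro hbS
    have h1 := Metric.infDist_le_dist_of_mem (x := (0 : ℝ)) (show b ∈ S from hbS)
    rw [ha, dist_zero_left, dist_zero_left, Real.norm_eq_abs, Real.norm_eq_abs] at h1
    linarith
  have ha0 : a ≠ 0 := by
    rintro rfl
    simp [hS, hf0, hg0] at haS
  have hapos := abs_pos.2 ha0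
  have hscale : ∀ k : ℝ, |k| < 1 → f (k * a) ≠ 0 ∧ g (k * a) ≠ 0 := fun k hk =>
    hmin _ (by rw [abs_mul]; nlinarith)
  have hbm : |(|m| / 2)| < 1 := by rw [abs_of_pos (by positivity)]; linarith
  have hbn : |(|n| / 2)| < 1 := by rw [abs_of_pos (by positivity)]; linarith
  have hsum : |m| / 2 + |n| / 2 = 1 := by linarith
  rcases mul_eq_zero.1 haS with hfa | hga
  · have h1 := h (|n| / 2 * a) (|m| / 2 * a)
    rw [← add_mul, add_comm (|n| / 2), hsum, one_mul, hfa, zero_mul, ← mul_assoc m,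
      ← mul_assoc n] at h1
    have hb : |m| * (|n| / 2) < 1 := by nlinarith [sq_nonneg (|m| - |n|)]
    refine mul_ne_zero (mul_ne_zero (hscale _ hbn).1 (hscale _ ?_).2)
      (mul_ne_zero (hscale _ hbm).1 (hscale _ ?_).2) h1.symm
    · rwa [abs_mul, abs_of_pos (show 0 < |n| / 2 by positivity)]
    · rw [abs_mul, abs_of_pos (show 0 < |m| / 2 by positivity)]
      linarith
  · have hs : ∀ k : ℝ, k ≠ 0 → |k| / 2 / k * k = |k| / 2 := fun k hk => div_mul_cancel₀ _ hk
    have hhalf : ∀ k : ℝ, k ≠ 0 → |(|k| / 2 / k)| < 1 := by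
      intro k hk
      have := abs_pos.2 hk
      rw [abs_div, abs_div, abs_abs, abs_two, div_div, div_lt_one (by positivity)]
      linarith
    have h1 := h (|m| / 2 / m * a) (|n| / 2 / n * a)
    rw [← mul_assoc m, ← mul_assoc n, mul_comm m, mul_comm n, hs m hm, hs n hn, ← add_mul (|m| / 2),
      hsum, one_mul, hga, mul_zero] at h1
    exact mul_ne_zero (mul_ne_zero (hscale _ (hhalf m hm)).1 (hscale _ hbm).2)
      (mul_ne_zero (hscale _ (hhalf n hn)).1 (hscale _ hbn).2) h1.symm

/-- The version of `mul_ne_zero_of_map_add_mul_eq` without normalization of the coefficients. -/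
theorem ne_zero_of_map_add_mul_eq {f g : ℝ → ℂ} (hf : Continuous f) (hg : Continuous g)
    (hf0 : f 0 = 1) (hg0 : g 0 = 1) {m n : ℝ} (hm : m ≠ 0) (hn : n ≠ 0)
    (h : ∀ x y, f (x + y) * g (m * x + n * y) = f x * g (m * x) * (f y * g (n * y))) :
    (∀ t, f t ≠ 0) ∧ ∀ t, g t ≠ 0 := by
  have hm' := abs_pos.2 hm
  have hn' := abs_pos.2 hn
  obtain ⟨k, hk, hkeq⟩ : ∃ k : ℝ, 0 < k ∧ (|m| + |n|) = 2 * k :=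
    ⟨(|m| + |n|) / 2, by positivity, by ring⟩
  have key := mul_ne_zero_of_map_add_mul_eq (f := f) (g := fun t => g (k * t)) (m := m / k)
    (n := n / k) hf (by fun_prop) hf0 (by simpa using hg0) (div_ne_zero hm hk.ne')
    (div_ne_zero hn hk.ne')
    (by rw [abs_div, abs_div, abs_of_pos hk, ← add_div, hkeq]; field_simp)
    (by
      intro x y
      have e : ∀ a t : ℝ, k * (a / k * t) = a * t := fun a t => by field_simp
      simp only [mul_add, e]
      exact h x y)
  refine ⟨fun t => left_ne_zero_of_mul (key t), fun t => ?_⟩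
  have := right_ne_zero_of_mul (key (t / k))
  rwa [mul_div_cancel₀ _ hk.ne'] at this

/-- If `f (x + y) * g (m * x + n * y)` splits as a product, with `m ≠ n`, then `log f` has
vanishing third differences. -/
theorem third_difference_of_map_add_mul_eq {f g : ℝ → ℂ} (hg0 : g 0 = 1)
    (hg : ∀ t, g t ≠ 0) {m n : ℝ} (hmn : m ≠ n)
    (h : ∀ x y, f (x + y) * g (m * x + n * y) = f x * g (m * x) * (f y * g (n * y)))
    (x y z : ℝ) :
    f (x + y + z) * f x * f y * f z = f (x + y) * f (x + z) * f (y + z) := by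
  obtain ⟨a, b, hab, hker⟩ : ∃ a b : ℝ, a + b = x ∧ m * a + n * b = 0 := by
    have := sub_ne_zero.2 hmn
    refine ⟨-n * x / (m - n), m * x / (m - n), ?_, ?_⟩
    · field_simp
      ring
    · field_simp
      ring
  have hrep : ∀ s t, f (s + t) = f s * g (m * s) * (f t * g (n * t)) / g (m * s + n * t) :=
    fun s t => by rw [eq_div_iff (hg _), h]
  have e1 := hrep (a + y) (b + z)
  have e2 := hrep a b
  have e3 := hrep (a + y) b
  have e4 := hrep a (b + z)
  have e5 := hrep y z
  rw [show a + y + (b + z) = x + y + z by rw [← hab]; ring,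
    show m * (a + y) + n * (b + z) = m * y + n * z by linear_combination hker] at e1
  rw [hab, hker, hg0, div_one] at e2
  rw [show a + y + b = x + y by rw [← hab]; ring,
    show m * (a + y) + n * b = m * y by linear_combination hker] at e3
  rw [show a + (b + z) = x + z by rw [← hab]; ring,
    show m * a + n * (b + z) = n * z by linear_combination hker] at e4
  rw [e1, e2, e3, e4, e5]
  have h1 := hg (m * y)
  have h2 := hg (n * z)
  have h3 := hg (m * y + n * z)
  generalize g (m * y) = A at *
  generalize g (n * z) = B at *
  generalize g (m * y + n * z) = C at *
  field_simp

/-- The characteristic function of a probability measure is multiplicative if it is unimodular. -/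
theorem charFun_add_of_norm_eq_one (μ : Measure ℝ) [IsProbabilityMeasure μ]
    (h : ∀ t, ‖charFun μ t‖ = 1) (s t : ℝ) :
    charFun μ (s + t) = charFun μ s * charFun μ t := by
  have hae : (fun x : ℝ => Complex.exp (s * x * Complex.I)) =ᵐ[μ] fun _ => charFun μ s := by
    have hle : ∀ᵐ x : ℝ ∂μ, ‖Complex.exp (s * x * Complex.I)‖ ≤ 1 := by
      filter_upwards with x
      rw [← Complex.ofReal_mul, Complex.norm_exp_ofReal_mul_I]
    rcases ae_eq_const_or_norm_integral_lt_of_norm_le_const hle with h1 | h1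
    · rwa [average_eq_integral, ← charFun_apply_real] at h1
    · rw [← charFun_apply_real, h] at h1
      simp at h1
  rw [charFun_apply_real, charFun_apply_real t, ← integral_const_mul]
  refine integral_congr_ae ?_
  filter_upwards [hae] with x hx
  rw [← hx, ← Complex.exp_add]
  congr 1
  push_cast
  ring

/-- The two-variable functional equation for characteristic functions expressing the independence
of two linear forms. -/
theorem charFun_mul_charFun_of_indepFun_linear {Ω : Type*} [MeasurableSpace Ω] {P : Measure Ω}
    [IsProbabilityMeasure P] {u v : Ω → ℝ} (hu : Measurable u) (hv : Measurable v)
    (huv : IndepFun u v P) {p q r s : ℝ}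
    (hzw : IndepFun (fun ω => p * u ω + q * v ω) (fun ω => r * u ω + s * v ω) P) (a b : ℝ) :
    charFun (P.map u) (p * a + r * b) * charFun (P.map v) (q * a + s * b) =
      charFun (P.map u) (p * a) * charFun (P.map v) (q * a) *
        (charFun (P.map u) (r * b) * charFun (P.map v) (s * b)) := by
  have hlin : ∀ c d t : ℝ, charFun (P.map fun ω => c * u ω + d * v ω) t =
      charFun (P.map u) (c * t) * charFun (P.map v) (d * t) := by
    intro c d t
    rw [← charFun_map_mul_comp hu.aemeasurable, ← charFun_map_mul_comp hv.aemeasurable]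
    exact congrFun (IndepFun.charFun_map_fun_add_eq_mul (by fun_prop) (by fun_prop)
      (huv.comp (measurable_const_mul c) (measurable_const_mul d))) t
  have h1 := congrFun (IndepFun.charFun_map_fun_add_eq_mul (by fun_prop) (by fun_prop)
    (hzw.comp (measurable_const_mul a) (measurable_const_mul b))) 1
  rw [Pi.mul_apply] at h1
  simp only [Function.comp_def] at h1
  rw [charFun_map_mul_comp (by fun_prop), charFun_map_mul_comp (by fun_prop), mul_one, mul_one,
    hlin, hlin] at h1
  rw [← h1]
  have h4 := hlin (p * a + r * b) (q * a + s * b) 1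
  rw [mul_one, mul_one] at h4
  rw [← h4]
  congr 2
  funext ω
  ring

/-- If `f (x + y) = f x * f y` holds whenever `g y ≠ 0`, with `g` continuous and `g 0 ≠ 0`, then it
holds everywhere. -/
theorem map_add_of_map_add_mul_eq {f g : ℝ → ℂ} (hg : Continuous g) (hg0 : g 0 ≠ 0)
    (h : ∀ x y, f (x + y) * g y = f x * f y * g y) (x y : ℝ) : f (x + y) = f x * f y := by
  have hstep : ∀ (k : ℕ) (y : ℝ), (∀ x, f (x + y / 2 ^ k) = f x * f (y / 2 ^ k)) →
      ∀ x, f (x + y) = f x * f y := by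
    intro k
    induction k with
    | zero => simp
    | succ k ih =>
      intro y hy
      refine ih y fun x => ?_
      have e : y / 2 ^ k = y / 2 ^ (k + 1) + y / 2 ^ (k + 1) := by rw [pow_succ]; ring
      rw [e, ← add_assoc, hy, hy, hy, mul_assoc]
  have hlim : Filter.Tendsto (fun k : ℕ => y / 2 ^ k) Filter.atTop (nhds 0) := by
    have h1 := (tendsto_pow_atTop_nhds_zero_of_lt_one (r := (1 / 2 : ℝ)) (by norm_num)
      (by norm_num)).const_mul y
    simpa [div_eq_mul_inv] using h1
  obtain ⟨k, hk⟩ := (((hg.tendsto 0).comp hlim).eventually_ne hg0).exists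
  exact hstep k y (fun x => mul_right_cancel₀ hk (h x _)) x

/-- A probability measure on `ℝ` with multiplicative characteristic function is Gaussian. -/
theorem exists_eq_gaussianReal_of_charFun_add (μ : Measure ℝ) [IsProbabilityMeasure μ]
    (h : ∀ x y, charFun μ (x + y) = charFun μ x * charFun μ y) :
    ∃ (m : ℝ) (v : NNReal), μ = gaussianReal m v := by
  refine exists_eq_gaussianReal_of_charFun_third_difference μ (fun t ht => ?_) fun x y z => ?_
  · simpa [ht] using h t (-t)
  · simp only [h]
    ring

/-- The conclusion of the Darmois–Skitovich theorem for the first variable, in terms of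
characteristic functions. -/
theorem exists_eq_gaussianReal_of_charFun_mul (μ ν : Measure ℝ) [IsProbabilityMeasure μ]
    [IsProbabilityMeasure ν] {m n : ℝ}
    (h : ∀ x y, charFun μ (x + y) * charFun ν (m * x + n * y) =
      charFun μ x * charFun ν (m * x) * (charFun μ y * charFun ν (n * y))) :
    ∃ (a : ℝ) (v : NNReal), μ = gaussianReal a v := by
  have hf : Continuous (charFun μ) := continuous_charFun
  have hg : Continuous (charFun ν) := continuous_charFun
  have hf0 : charFun μ 0 = 1 := by simp
  have hg0 : charFun ν 0 = 1 := by simp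
  by_cases hmn : m = n
  · -- here `f x * g (m * x)` is multiplicative, so `f` is unimodular
    subst hmn
    refine exists_eq_gaussianReal_of_charFun_add μ (charFun_add_of_norm_eq_one μ fun t => ?_)
    have h1 := congrArg norm (h t (-t))
    rw [mul_neg, add_neg_cancel, add_neg_cancel, hf0, hg0, charFun_neg, charFun_neg] at h1
    simp only [norm_mul, RCLike.norm_conj, norm_one, mul_one] at h1
    have h2 := norm_charFun_le_one (μ := μ) t
    have h3 := norm_charFun_le_one (μ := ν) (m * t)
    have h4 := norm_nonneg (charFun μ t)
    have h5 := norm_nonneg (charFun ν (m * t))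
    nlinarith [mul_le_one₀ h2 h5 h3, mul_nonneg h4 h5]
  by_cases hmn0 : m ≠ 0 ∧ n ≠ 0
  · obtain ⟨hfne, hgne⟩ := ne_zero_of_map_add_mul_eq hf hg hf0 hg0 hmn0.1 hmn0.2 h
    exact exists_eq_gaussianReal_of_charFun_third_difference μ hfne
      (third_difference_of_map_add_mul_eq hg0 hgne hmn h)
  rw [not_and_or, not_ne_iff, not_ne_iff] at hmn0
  refine exists_eq_gaussianReal_of_charFun_add μ ?_
  rcases hmn0 with rfl | rfl
  · refine map_add_of_map_add_mul_eq (g := fun t => charFun ν (n * t)) (by fun_prop) (by simp)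
      fun x y => ?_
    simpa [mul_assoc] using h x y
  · refine map_add_of_map_add_mul_eq (g := fun t => charFun ν (m * t)) (by fun_prop) (by simp)
      fun x y => ?_
    have h1 := h y x
    simp only [zero_mul, add_zero, hg0, mul_one] at h1
    rw [add_comm x, h1]
    ring

/-- **Darmois–Skitovich theorem.** If `u` and `v` are independent real random variables,
`z = p·u + q·v` and `w = r·u + s·v` are independent, then `p·r ≠ 0` implies `u` is Gaussian
and `q·s ≠ 0` implies `v` is Gaussian. -/
theorem darmois_skitovich {Ω : Type*} [MeasurableSpace Ω] (P : Measure Ω)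
    [IsProbabilityMeasure P] (u v : Ω → ℝ) (hu : Measurable u) (hv : Measurable v)
    (huv : IndepFun u v P) (p q r s : ℝ)
    (z w : Ω → ℝ)
    (hz : z = fun ω => p * u ω + q * v ω)
    (hw : w = fun ω => r * u ω + s * v ω)
    (hzw : IndepFun z w P) :
    (p * r ≠ 0 → IsGaussianRV P u) ∧ (q * s ≠ 0 → IsGaussianRV P v) := by
  subst hz hw
  have key := charFun_mul_charFun_of_indepFun_linear hu hv huv hzw
  have := Measure.isProbabilityMeasure_map (μ := P) hu.aemeasurable
  have := Measure.isProbabilityMeasure_map (μ := P) hv.aemeasurable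
  constructor
  · intro h
    obtain ⟨hp, hr⟩ := mul_ne_zero_iff.1 h
    refine exists_eq_gaussianReal_of_charFun_mul (P.map u) (P.map v) (m := q / p) (n := s / r)
      fun x y => ?_
    have h1 := key (x / p) (y / r)
    rw [mul_div_cancel₀ _ hp, mul_div_cancel₀ _ hr] at h1
    simpa only [div_mul_eq_mul_div, mul_div_assoc] using h1
  · intro h
    obtain ⟨hq, hs⟩ := mul_ne_zero_iff.1 h
    refine exists_eq_gaussianReal_of_charFun_mul (P.map v) (P.map u) (m := p / q) (n := r / s)
      fun x y => ?_
    have h1 := key (x / q) (y / s)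
    rw [mul_div_cancel₀ _ hq, mul_div_cancel₀ _ hs] at h1
    simp only [div_mul_eq_mul_div, mul_div_assoc]
    linear_combination h1
end

section
/- Let e1 and e2 be independent real-valued random variables with e1 ~ N(0, σ1²) and e2 ~ N(0, σ2²), where σ1², σ2² > 0. Set X = e1 and Y = a·X + e2 for a real constant a. Define a' = Cov[X,Y]/V[Y] and e2' = X − a'·Y. Then Y and e2' are independent. -/
open MeasureTheory ProbabilityTheory

/-- Covariance of two real random variables: `Cov[X,Y] = E[(X − E X)(Y − E Y)]`. -/
noncomputable def covRV {Ω : Type*} [MeasurableSpace Ω] (P : Measure Ω) (X Y : Ω → ℝ) : ℝ :=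
  ∫ ω, (X ω - ∫ ω', X ω' ∂P) * (Y ω - ∫ ω', Y ω' ∂P) ∂P

/-- If `(X, Y)` is jointly Gaussian and `Y` is non-degenerate, then `Y` is independent of the
residual of the linear regression of `X` on `Y`. -/
theorem ProbabilityTheory.HasGaussianLaw.indepFun_sub_regression {Ω : Type*} [MeasurableSpace Ω]
    {P : Measure Ω} {X Y : Ω → ℝ}
    (h : HasGaussianLaw (fun ω => (X ω, Y ω)) P) (hY : variance Y P ≠ 0) :
    IndepFun Y (fun ω => X ω - covariance X Y P / variance Y P * Y ω) P := by
  have := h.isProbabilityMeasure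
  set c := covariance X Y P / variance Y P with hc
  have hX2 : MemLp X 2 P := h.fst.memLp_two
  have hY2 : MemLp Y 2 P := h.snd.memLp_two
  have hpair : HasGaussianLaw (fun ω => (Y ω, X ω - c * Y ω)) P :=
    h.map_fun ((ContinuousLinearMap.snd ℝ ℝ ℝ).prod
      (ContinuousLinearMap.fst ℝ ℝ ℝ - c • ContinuousLinearMap.snd ℝ ℝ ℝ))
  refine hpair.indepFun_of_covariance_eq_zero ?_
  rw [covariance_fun_sub_right hY2 hX2 (hY2.const_mul c), covariance_const_mul_right,
    covariance_self hY2.aestronglyMeasurable.aemeasurable, covariance_comm, hc,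
    div_mul_cancel₀ _ hY, sub_self]

/-- If `e1 ~ N(0, v1)` and `e2 ~ N(0, v2)` are independent Gaussians with positive variances,
`X = e1`, `Y = a·X + e2`, `a' = Cov[X,Y]/V[Y]`, and `e2' = X − a'·Y`, then `Y` and `e2'`
are independent. -/
theorem gaussian_backward_indep {Ω : Type*} [MeasurableSpace Ω] (P : Measure Ω)
    [IsProbabilityMeasure P] (e1 e2 : Ω → ℝ)
    (he1 : Measurable e1) (he2 : Measurable e2)
    (hind : IndepFun e1 e2 P)
    (v1 v2 : NNReal) (hv1 : 0 < v1) (hv2 : 0 < v2)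
    (hl1 : Measure.map e1 P = gaussianReal 0 v1)
    (hl2 : Measure.map e2 P = gaussianReal 0 v2)
    (a : ℝ) (X Y : Ω → ℝ)
    (hX : X = e1) (hY : Y = fun ω => a * X ω + e2 ω)
    (a' : ℝ) (ha' : a' = covRV P X Y / variance Y P)
    (e2' : Ω → ℝ) (he2' : e2' = fun ω => X ω - a' * Y ω) :
    IndepFun Y e2' P := by
  subst hX hY he2' ha'
  have hG1 : HasGaussianLaw X P := ⟨by rw [hl1]; infer_instance⟩
  have hG2 : HasGaussianLaw e2 P := ⟨by rw [hl2]; infer_instance⟩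
  have hpair : HasGaussianLaw (fun ω => (X ω, a * X ω + e2 ω)) P :=
    (hind.hasGaussianLaw hG1 hG2).map_fun ((ContinuousLinearMap.fst ℝ ℝ ℝ).prod
      (a • ContinuousLinearMap.fst ℝ ℝ ℝ + ContinuousLinearMap.snd ℝ ℝ ℝ))
  have hvar2 : variance e2 P = v2 := by
    rw [← variance_id_map he2.aemeasurable, hl2, variance_id_gaussianReal]
  have hvar : variance (fun ω => a * X ω + e2 ω) P ≠ 0 := by
    rw [IndepFun.variance_fun_add (hG1.memLp_two.const_mul a) hG2.memLp_two
      (hind.comp (measurable_const_mul a) measurable_id), hvar2]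
    have := variance_nonneg (fun ω => a * X ω) P
    positivity
  exact hpair.indepFun_sub_regression hvar
end
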